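/- Let u, v ∈ ℕ and let M be a u × v matrix with entries from ℝ⁺ ∪ {0} with no row equal to the zero row. If C ⊆ ℝ⁺ is a C* set near zero in ℝ⁺, then {x ∈ (ℝ⁺)^v : M·x ∈ C^u} is a C* set near zero in (ℝ⁺)^v. -/

import Mathlib

open Set Filter

attribute [local instance] Ultrafilter.add Ultrafilter.addSemigroup

/-- The positive reals `ℝ⁺ = (0,∞)` as a type, a discrete additive semigroup. -/
abbrev Rpos : Type := {x : ℝ // 0 < x}

/-- `0⁺(ℝ⁺)`: ultrafilters on `ℝ⁺` containing `(0,ε)` for every `ε > 0`. -/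
def zeroPlus1 : Set (Ultrafilter Rpos) :=
  {p | ∀ ε : ℝ, 0 < ε → {x : Rpos | (x : ℝ) < ε} ∈ p}

/-- `0⁺((ℝ⁺)^v)`: ultrafilters on `(ℝ⁺)^v` containing `(0,ε)^v` for every `ε > 0`. -/
def zeroPlusV (v : ℕ) : Set (Ultrafilter (Fin v → Rpos)) :=
  {p | ∀ ε : ℝ, 0 < ε → {x : Fin v → Rpos | ∀ j, (x j : ℝ) < ε} ∈ p}

/-- `A ⊆ (ℝ⁺)^v` is a *J set near zero*: for every finite nonempty family `F` of
sequences in `(ℝ⁺)^v` converging to the zero vector and every `δ > 0`, there are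
`a ∈ (0,δ)^v` and a finite nonempty `H ⊆ ℕ` with `a + ∑_{t∈H} f(t) ∈ A` for all
`f ∈ F`. -/
def JSetNearZeroV (v : ℕ) (A : Set (Fin v → Rpos)) : Prop :=
  ∀ F : Set (ℕ → Fin v → Rpos), F.Finite → F.Nonempty →
    (∀ f ∈ F, ∀ ε : ℝ, 0 < ε → ∃ N : ℕ, ∀ n ≥ N, ∀ j, (f n j : ℝ) < ε) →
    ∀ δ : ℝ, 0 < δ →
      ∃ a : Fin v → Rpos, (∀ j, (a j : ℝ) < δ) ∧ ∃ H : Finset ℕ, H.Nonempty ∧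
        ∀ f ∈ F, ∃ y ∈ A, ∀ j, (y j : ℝ) = (a j : ℝ) + ∑ t ∈ H, (f t j : ℝ)

/-- `J₀((ℝ⁺)^v)`: the members of `0⁺((ℝ⁺)^v)` all of whose members are J sets near
zero. -/
def J0V (v : ℕ) : Set (Ultrafilter (Fin v → Rpos)) :=
  {p | p ∈ zeroPlusV v ∧ ∀ A, A ∈ p → JSetNearZeroV v A}

/-- `A ⊆ ℝ⁺` is a *J set near zero*: for every finite nonempty family `F` of sequences
in `ℝ⁺` converging to zero and every `δ > 0`, there are `a ∈ (0,δ)` and a finite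
nonempty `H ⊆ ℕ` with `a + ∑_{t∈H} f(t) ∈ A` for all `f ∈ F`. -/
def JSetNearZero1 (A : Set Rpos) : Prop :=
  ∀ F : Set (ℕ → Rpos), F.Finite → F.Nonempty →
    (∀ f ∈ F, ∀ ε : ℝ, 0 < ε → ∃ N : ℕ, ∀ n ≥ N, (f n : ℝ) < ε) →
    ∀ δ : ℝ, 0 < δ →
      ∃ a : Rpos, (a : ℝ) < δ ∧ ∃ H : Finset ℕ, H.Nonempty ∧
        ∀ f ∈ F, ∃ y ∈ A, (y : ℝ) = (a : ℝ) + ∑ t ∈ H, (f t : ℝ)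

/-- `J₀(ℝ⁺)`: the members of `0⁺(ℝ⁺)` all of whose members are J sets near zero. -/
def J01 : Set (Ultrafilter Rpos) :=
  {p | p ∈ zeroPlus1 ∧ ∀ A, A ∈ p → JSetNearZero1 A}

/-- `A ⊆ ℝ⁺` is a *C\* set near zero*: `A` belongs to every idempotent in `J₀(ℝ⁺)`. -/
def CStar1 (A : Set Rpos) : Prop :=
  ∀ p : Ultrafilter Rpos, p ∈ J01 → p + p = p → A ∈ p

/-- `A ⊆ (ℝ⁺)^v` is a *C\* set near zero*: `A` belongs to every idempotent in
`J₀((ℝ⁺)^v)`. -/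
def CStarV (v : ℕ) (A : Set (Fin v → Rpos)) : Prop :=
  ∀ p : Ultrafilter (Fin v → Rpos), p ∈ J0V v → p + p = p → A ∈ p

/-- The additive map `(ℝ⁺)^v → ℝ⁺` given by a nonzero row of nonnegative coefficients. -/
noncomputable def rowMap {v : ℕ} (r : Fin v → ℝ) (hr : ∀ j, 0 ≤ r j) (hne : ∃ j, r j ≠ 0)
    (x : Fin v → Rpos) : Rpos :=
  ⟨∑ j, r j * (x j : ℝ), by
    obtain ⟨j, hj⟩ := hne
    exact Finset.sum_pos' (fun k _ => mul_nonneg (hr k) (x k).2.le)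
      ⟨j, Finset.mem_univ j, mul_pos (lt_of_le_of_ne (hr j) hj.symm) (x j).2⟩⟩

section

variable {v : ℕ} {r : Fin v → ℝ} (hr : ∀ j, 0 ≤ r j) (hne : ∃ j, r j ≠ 0)

lemma rowMap_add (x y : Fin v → Rpos) :
    rowMap r hr hne (x + y) = rowMap r hr hne x + rowMap r hr hne y := by
  apply Subtype.ext
  simp [rowMap, mul_add, Finset.sum_add_distrib]

lemma row_sum_pos (hr : ∀ j, 0 ≤ r j) (hne : ∃ j, r j ≠ 0) : 0 < ∑ j, r j := by
  obtain ⟨j, hj⟩ := hne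
  exact Finset.sum_pos' (fun k _ => hr k)
    ⟨j, Finset.mem_univ j, lt_of_le_of_ne (hr j) hj.symm⟩

lemma rowMap_lt {x : Fin v → Rpos} {δ : ℝ} (hx : ∀ j, (x j : ℝ) < δ / ∑ j, r j) :
    (rowMap r hr hne x : ℝ) < δ := by
  have hs := row_sum_pos hr hne
  obtain ⟨j, hj⟩ := hne
  calc ∑ j, r j * (x j : ℝ) < ∑ j, r j * (δ / ∑ j, r j) :=
        Finset.sum_lt_sum (fun k _ => mul_le_mul_of_nonneg_left (hx k).le (hr k))
          ⟨j, Finset.mem_univ j,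
            mul_lt_mul_of_pos_left (hx j) (lt_of_le_of_ne (hr j) hj.symm)⟩
    _ = δ := by rw [← Finset.sum_mul]; field_simp

/-- A set whose preimage under a row map is a J set near zero is a J set near zero. -/
lemma JSetNearZero1_of_preimage {A : Set Rpos}
    (hA : JSetNearZeroV v (rowMap r hr hne ⁻¹' A)) : JSetNearZero1 A := by
  intro F hF hFne hF0 δ hδ
  have hs := row_sum_pos hr hne
  let lift : (ℕ → Rpos) → ℕ → Fin v → Rpos := fun f t _ =>
    ⟨(f t : ℝ) / ∑ j, r j, div_pos (f t).2 hs⟩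
  obtain ⟨a, ha, H, hH, h⟩ := hA (lift '' F) (hF.image _) (hFne.image _) (by
    rintro _ ⟨f, hf, rfl⟩ ε hε
    obtain ⟨N, hN⟩ := hF0 f hf (ε * ∑ j, r j) (mul_pos hε hs)
    exact ⟨N, fun n hn _ => (div_lt_iff₀ hs).2 (hN n hn)⟩) _ (div_pos hδ hs)
  refine ⟨rowMap r hr hne a, rowMap_lt hr hne ha, H, hH, fun f hf => ?_⟩
  obtain ⟨y, hyA, hy⟩ := h _ (mem_image_of_mem lift hf)
  refine ⟨_, hyA, ?_⟩
  simp only [rowMap, hy, lift, mul_add, Finset.sum_add_distrib, ← Finset.sum_div,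
    ← Finset.sum_mul]
  field_simp

lemma map_rowMap_mem_J01 {p : Ultrafilter (Fin v → Rpos)} (hp : p ∈ J0V v) :
    p.map (rowMap r hr hne) ∈ J01 := by
  refine ⟨fun ε hε => ?_, fun A hA => JSetNearZero1_of_preimage hr hne (hp.2 _ hA)⟩
  exact Ultrafilter.mem_map.2 <| mem_of_superset (hp.1 _ (div_pos hε (row_sum_pos hr hne)))
    fun x hx => rowMap_lt hr hne hx

end

lemma Ultrafilter.map_add_of_additive {S T : Type*} [Add S] [Add T] {φ : S → T}
    (hφ : ∀ x y, φ (x + y) = φ x + φ y) (p q : Ultrafilter S) :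
    (p + q).map φ = p.map φ + q.map φ := by
  ext A
  change (∀ᶠ m in ((p + q : Ultrafilter S) : Filter S), φ m ∈ A) ↔
    ∀ᶠ m in ((p.map φ + q.map φ : Ultrafilter T) : Filter T), m ∈ A
  rw [Ultrafilter.eventually_add, Ultrafilter.eventually_add]
  simp [hφ, Filter.eventually_map]

/-- If `M` is a `u × v` matrix with entries from `ℝ⁺ ∪ {0}` and no zero row, and `C ⊆ ℝ⁺`
is a C\* set near zero in `ℝ⁺`, then `{x ∈ (ℝ⁺)^v : M·x ∈ C^u}` is a C\* set near zero in
`(ℝ⁺)^v`. -/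
theorem cStar_preserved {u v : ℕ} (hu : 1 ≤ u) (hv : 1 ≤ v)
    (M : Fin u → Fin v → ℝ) (hMnn : ∀ i j, 0 ≤ M i j) (hrow : ∀ i, ∃ j, M i j ≠ 0)
    (C : Set ℝ) (hC : C ⊆ Set.Ioi 0) (hCs : CStar1 {a : Rpos | (a : ℝ) ∈ C}) :
    CStarV v {x : Fin v → Rpos | ∀ i : Fin u, (∑ j, M i j * (x j : ℝ)) ∈ C} := by
  intro p hp hpp
  refine eventually_all.2 fun i => ?_
  exact hCs (p.map (rowMap (M i) (hMnn i) (hrow i))) (map_rowMap_mem_J01 _ _ hp) (by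
    rw [← Ultrafilter.map_add_of_additive (rowMap_add _ _), hpp])
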